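/- arXiv:2105.05989 — 2 statements merged into one kernel-verified Lean document; each statement's English description precedes it below -/
import Mathlib

section
/- Let P, Q be probability measures on ℝ with quantile functions F_P^←, F_Q^←, and let Υ : ℝ × ℝ → [0,∞) be a continuous quasi-antitone (submodular) cost function. Then among all couplings π of P and Q, the comonotone coupling P^com (with cdf min{F_P(u),F_Q(v)}) minimizes ∫ Υ dπ, and the minimal value equals ∫₀¹ Υ(F_P^←(x), F_Q^←(x)) dx. -/
open MeasureTheory Set

/-- Cumulative distribution function of a measure on `ℝ`. -/
noncomputable def cdf (P : Measure ℝ) (z : ℝ) : ℝ := (P (Iic z)).toReal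

/-- Quantile function (generalized inverse of the cdf). -/
noncomputable def quantile (P : Measure ℝ) (x : ℝ) : ℝ := sInf {z : ℝ | x ≤ cdf P z}

theorem stmt12_tele (G : ℕ → ℕ → ℝ) (i j : ℕ) :
    G i j = G i 0 + G 0 j - G 0 0 -
      ∑ k ∈ Finset.range i, ∑ l ∈ Finset.range j,
        (G (k+1) l + G k (l+1) - G k l - G (k+1) (l+1)) := by
  have h1 : ∀ k, ∑ l ∈ Finset.range j,
        (G (k+1) l + G k (l+1) - G k l - G (k+1) (l+1))
        = (G k j - G k 0) - (G (k+1) j - G (k+1) 0) := by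
    intro k
    rw [← Finset.sum_range_sub (fun l => G k l), ← Finset.sum_range_sub (fun l => G (k+1) l),
      ← Finset.sum_sub_distrib]
    exact Finset.sum_congr rfl fun l _ => by ring
  simp_rw [h1]
  rw [Finset.sum_range_sub' (fun k => G k j - G k 0)]
  ring

theorem stmt12_tele2 (G : ℕ → ℕ → ℝ) (M i j : ℕ) (hi : i ≤ M) (hj : j ≤ M) :
    G i j = G i 0 + G 0 j - G 0 0 -
      ∑ k ∈ Finset.range M, ∑ l ∈ Finset.range M,
        (G (k+1) l + G k (l+1) - G k l - G (k+1) (l+1)) * (if k < i ∧ l < j then 1 else 0) := by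
  rw [stmt12_tele G i j]
  congr 1
  have e : ∀ n ≤ M, Finset.range n = (Finset.range M).filter (fun k => k < n) := by
    intro n hn; ext k; simp; omega
  rw [e i hi, e j hj, Finset.sum_filter]
  refine Finset.sum_congr rfl fun k _ => ?_
  split_ifs with h
  · rw [Finset.sum_filter]
    refine Finset.sum_congr rfl fun l _ => ?_
    simp [h]
  · simp [h]

noncomputable def stmt12T (n : ℕ) (u : ℝ) : ℕ := min ⌈(u + n) * (n + 1)⌉₊ (2 * n * (n + 1))

theorem stmt12T_meas (n : ℕ) : Measurable (stmt12T n) := by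
  unfold stmt12T
  refine Measurable.min ?_ measurable_const
  exact Nat.measurable_ceil.comp (by fun_prop)

theorem stmt12T_lt (n k : ℕ) (hk : k < 2 * n * (n + 1)) (u : ℝ) :
    k < stmt12T n u ↔ (k : ℝ) / (n + 1) - n < u := by
  unfold stmt12T
  rw [lt_min_iff, and_iff_left hk, Nat.lt_ceil, sub_lt_iff_lt_add, div_lt_iff₀ (by positivity)]

theorem stmt12T_lim (u : ℝ) :
    Filter.Tendsto (fun n : ℕ => (stmt12T n u : ℝ) / (n + 1) - n) Filter.atTop (nhds u) := by
  have h1 : Filter.Tendsto (fun n : ℕ => u + 1 / ((n : ℝ) + 1)) Filter.atTop (nhds u) := by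
    simpa using (tendsto_const_nhds (x := u)).add tendsto_one_div_add_atTop_nhds_zero_nat
  obtain ⟨N, hN⟩ := exists_nat_ge |u|
  refine tendsto_of_tendsto_of_tendsto_of_le_of_le' tendsto_const_nhds h1 ?_ ?_
  all_goals
    filter_upwards [Filter.eventually_ge_atTop N] with n hn
    have hn' : |u| ≤ n := hN.trans (by exact_mod_cast hn)
    obtain ⟨ha, hb⟩ := abs_le.1 hn'
    have hp : (0 : ℝ) < n + 1 := by positivity
    have hT : stmt12T n u = ⌈(u + n) * (n + 1)⌉₊ := by
      unfold stmt12T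
      apply min_eq_left
      rw [Nat.ceil_le]; push_cast
      apply mul_le_mul_of_nonneg_right _ hp.le
      linarith
    rw [hT]
  · rw [le_sub_iff_add_le, le_div_iff₀ hp]
    exact Nat.le_ceil _
  · have := (Nat.ceil_lt_add_one (a := (u + n) * (n + 1)) (mul_nonneg (by linarith) hp.le)).le
    rw [sub_le_iff_le_add, div_le_iff₀ hp]
    refine this.trans (le_of_eq ?_)
    field_simp
    ring

theorem stmt12_disc (π : Measure (ℝ × ℝ)) [IsProbabilityMeasure π] (G : ℕ → ℕ → ℝ)
    (C : ℝ) (hC : ∀ i j, |G i j| ≤ C) (n : ℕ) :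
    ∫ p, G (stmt12T n p.1) (stmt12T n p.2) ∂π =
      ∫ u, G (stmt12T n u) 0 ∂(π.map Prod.fst) + ∫ v, G 0 (stmt12T n v) ∂(π.map Prod.snd)
       - G 0 0 - ∑ k ∈ Finset.range (2 * n * (n + 1)), ∑ l ∈ Finset.range (2 * n * (n + 1)),
        (G (k+1) l + G k (l+1) - G k l - G (k+1) (l+1)) *
          π.real (Ioi ((k : ℝ) / (n + 1) - n) ×ˢ Ioi ((l : ℝ) / (n + 1) - n)) := by
  have m1 : Measurable fun u => G (stmt12T n u) 0 :=
    (measurable_of_countable (fun i => G i 0)).comp (stmt12T_meas n)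
  have m2 : Measurable fun u => G 0 (stmt12T n u) :=
    (measurable_of_countable (fun i => G 0 i)).comp (stmt12T_meas n)
  rw [integral_map measurable_fst.aemeasurable m1.aestronglyMeasurable,
    integral_map measurable_snd.aemeasurable m2.aestronglyMeasurable]
  have i1 : Integrable (fun p : ℝ × ℝ => G (stmt12T n p.1) 0) π :=
    Integrable.of_bound (m1.comp measurable_fst).aestronglyMeasurable C (ae_of_all _ fun p => hC _ _)
  have i2 : Integrable (fun p : ℝ × ℝ => G 0 (stmt12T n p.2)) π :=
    Integrable.of_bound (m2.comp measurable_snd).aestronglyMeasurable C (ae_of_all _ fun p => hC _ _)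
  have hI : ∀ a b : ℝ, Integrable (Set.indicator (Ioi a ×ˢ Ioi b) (fun _ : ℝ × ℝ => (1:ℝ))) π :=
    fun a b => (integrable_const _).indicator (measurableSet_Ioi.prod measurableSet_Ioi)
  have key : ∀ p : ℝ × ℝ, G (stmt12T n p.1) (stmt12T n p.2) =
      G (stmt12T n p.1) 0 + G 0 (stmt12T n p.2) - G 0 0 -
      ∑ k ∈ Finset.range (2 * n * (n + 1)), ∑ l ∈ Finset.range (2 * n * (n + 1)),
        (G (k+1) l + G k (l+1) - G k l - G (k+1) (l+1)) *
          Set.indicator (Ioi ((k : ℝ) / (n + 1) - n) ×ˢ Ioi ((l : ℝ) / (n + 1) - n))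
            (fun _ : ℝ × ℝ => (1:ℝ)) p := by
    intro p
    rw [stmt12_tele2 G (2 * n * (n + 1)) (stmt12T n p.1) (stmt12T n p.2) (min_le_right _ _)
      (min_le_right _ _)]
    congr 1
    refine Finset.sum_congr rfl fun k hk => Finset.sum_congr rfl fun l hl => ?_
    congr 1
    rw [Set.indicator_apply]
    simp only [stmt12T_lt n k (Finset.mem_range.1 hk), stmt12T_lt n l (Finset.mem_range.1 hl),
      Set.mem_prod, Set.mem_Ioi]
  simp_rw [key]
  have i3 : Integrable (fun p => ∑ k ∈ Finset.range (2 * n * (n + 1)),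
      ∑ l ∈ Finset.range (2 * n * (n + 1)),
        (G (k+1) l + G k (l+1) - G k l - G (k+1) (l+1)) *
          Set.indicator (Ioi ((k : ℝ) / (n + 1) - n) ×ˢ Ioi ((l : ℝ) / (n + 1) - n))
            (fun _ : ℝ × ℝ => (1:ℝ)) p) π :=
    integrable_finsetSum _ fun k _ => integrable_finsetSum _ fun l _ => (hI _ _).const_mul _
  have i12 : Integrable (fun p : ℝ × ℝ => G (stmt12T n p.1) 0 + G 0 (stmt12T n p.2)) π := i1.add i2
  have i12' : Integrable (fun p : ℝ × ℝ =>
      G (stmt12T n p.1) 0 + G 0 (stmt12T n p.2) - G 0 0) π := i12.sub (integrable_const _)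
  rw [integral_sub i12' i3, integral_sub i12 (integrable_const _), integral_add i1 i2]
  rw [integral_finsetSum _ fun k _ => integrable_finsetSum _ fun l _ => (hI _ _).const_mul _]
  simp_rw [integral_finsetSum _ fun l _ => (hI _ _).const_mul _, integral_const_mul,
    integral_indicator_const (1:ℝ) (measurableSet_Ioi.prod measurableSet_Ioi)]
  simp

theorem stmt12_bdd (π π' : Measure (ℝ × ℝ)) [IsProbabilityMeasure π] [IsProbabilityMeasure π']
    (h1 : π.map Prod.fst = π'.map Prod.fst) (h2 : π.map Prod.snd = π'.map Prod.snd)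
    (h : ∀ a b : ℝ, π (Ioi a ×ˢ Ioi b) ≤ π' (Ioi a ×ˢ Ioi b))
    (Υ : ℝ → ℝ → ℝ) (hcont : Continuous (fun p : ℝ × ℝ => Υ p.1 p.2))
    (C : ℝ) (hC : ∀ u v : ℝ, |Υ u v| ≤ C)
    (hqa : ∀ u₁ u₂ v₁ v₂ : ℝ, u₁ ≤ u₂ → v₁ ≤ v₂ →
      Υ u₁ v₁ + Υ u₂ v₂ ≤ Υ u₂ v₁ + Υ u₁ v₂) :
    ∫ p, Υ p.1 p.2 ∂π' ≤ ∫ p, Υ p.1 p.2 ∂π := by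
  let g : ℕ → ℕ → ℝ := fun n i => (i : ℝ) / (n + 1) - n
  have hlim : ∀ (ρ : Measure (ℝ × ℝ)) [IsProbabilityMeasure ρ], Filter.Tendsto
      (fun n : ℕ => ∫ p, Υ (g n (stmt12T n p.1)) (g n (stmt12T n p.2)) ∂ρ) Filter.atTop
      (nhds (∫ p, Υ p.1 p.2 ∂ρ)) := by
    intro ρ _
    refine tendsto_integral_of_dominated_convergence (fun _ => C) ?_ (integrable_const _) ?_ ?_
    · intro n
      have hm : Measurable fun u => g n (stmt12T n u) :=
        (measurable_of_countable (g n)).comp (stmt12T_meas n)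
      exact (hcont.measurable.comp ((hm.comp measurable_fst).prodMk
        (hm.comp measurable_snd))).aestronglyMeasurable
    · exact fun n => ae_of_all _ fun p => hC _ _
    · exact ae_of_all _ fun p =>
        (hcont.tendsto p).comp ((stmt12T_lim p.1).prodMk_nhds (stmt12T_lim p.2))
  refine le_of_tendsto_of_tendsto' (hlim π') (hlim π) fun n => ?_
  have hg : Monotone (g n) := by
    intro i j hij
    have : (i : ℝ) ≤ j := by exact_mod_cast hij
    simp only [g]
    gcongr
  rw [stmt12_disc π (fun i j => Υ (g n i) (g n j)) C (fun _ _ => hC _ _) n,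
    stmt12_disc π' (fun i j => Υ (g n i) (g n j)) C (fun _ _ => hC _ _) n, h1, h2]
  refine sub_le_sub_left (Finset.sum_le_sum fun k _ => Finset.sum_le_sum fun l _ => ?_) _
  refine mul_le_mul_of_nonneg_left ?_ ?_
  · exact ENNReal.toReal_mono (measure_ne_top _ _) (h _ _)
  · have := hqa _ _ _ _ (hg (Nat.le_succ k)) (hg (Nat.le_succ l))
    simp only [Nat.succ_eq_add_one] at this
    linarith

theorem stmt12_q_le (P : Measure ℝ) [IsProbabilityMeasure P] (x z : ℝ) (hx : x ∈ Ioo (0:ℝ) 1) :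
    quantile P x ≤ z ↔ x ≤ cdf P z := by
  have hF : ∀ z, cdf P z = ProbabilityTheory.cdf P z := fun z => by
    rw [ProbabilityTheory.cdf_eq_real]; rfl
  have hmono : Monotone (fun z => cdf P z) := by
    intro a b hab
    simp only [hF]
    exact ProbabilityTheory.monotone_cdf P hab
  have hbdd : BddBelow {z : ℝ | x ≤ cdf P z} := by
    have h0 := (ProbabilityTheory.tendsto_cdf_atBot P).eventually (gt_mem_nhds hx.1)
    obtain ⟨a, ha⟩ := h0.exists
    refine ⟨a, fun z hz => ?_⟩
    by_contra hlt
    have := hmono (not_le.1 hlt).le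
    simp only [Set.mem_setOf_eq] at hz
    rw [← hF] at ha
    simp only at this
    linarith
  have hne : {z : ℝ | x ≤ cdf P z}.Nonempty := by
    have h0 := (ProbabilityTheory.tendsto_cdf_atTop P).eventually (lt_mem_nhds hx.2)
    obtain ⟨a, ha⟩ := h0.exists
    exact ⟨a, by simp only [Set.mem_setOf_eq, hF]; exact ha.le⟩
  constructor
  · intro h
    have hgt : ∀ y, z < y → x ≤ cdf P y := by
      intro y hy
      obtain ⟨w, hw, hwy⟩ := exists_lt_of_csInf_lt hne (lt_of_le_of_lt h hy)
      exact le_trans hw (hmono hwy.le)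
    have hrc := ((ProbabilityTheory.cdf P).right_continuous z)
    have hrc' : Filter.Tendsto (ProbabilityTheory.cdf P) (nhdsWithin z (Ioi z))
        (nhds (ProbabilityTheory.cdf P z)) :=
      hrc.mono_left (nhdsWithin_mono _ Ioi_subset_Ici_self)
    rw [hF]
    refine ge_of_tendsto hrc' ?_
    filter_upwards [self_mem_nhdsWithin] with y hy
    rw [← hF]; exact hgt y hy
  · intro h
    exact csInf_le hbdd h

theorem stmt12_cdf_ofReal (P : Measure ℝ) [IsProbabilityMeasure P] (z : ℝ) :
    ENNReal.ofReal (cdf P z) = P (Iic z) :=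
  ENNReal.ofReal_toReal (measure_ne_top _ _)

theorem stmt12_cdf_le_one (P : Measure ℝ) [IsProbabilityMeasure P] (z : ℝ) : cdf P z ≤ 1 :=
  ENNReal.toReal_le_of_le_ofReal zero_le_one (by simpa using prob_le_one)

theorem stmt12_cdf_nonneg (P : Measure ℝ) (z : ℝ) : 0 ≤ cdf P z := ENNReal.toReal_nonneg

theorem stmt12_q_aem (P : Measure ℝ) [IsProbabilityMeasure P] :
    AEMeasurable (quantile P) (volume.restrict (Ioo (0:ℝ) 1)) := by
  refine aemeasurable_restrict_of_monotoneOn measurableSet_Ioo ?_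
  intro x hx y hy hxy
  rw [stmt12_q_le P x _ hx]
  exact hxy.trans ((stmt12_q_le P y _ hy).1 le_rfl)

noncomputable def stmt12com (P Q : Measure ℝ) : Measure (ℝ × ℝ) :=
  (volume.restrict (Ioo (0:ℝ) 1)).map (fun x => (quantile P x, quantile Q x))

theorem stmt12_pair_aem (P Q : Measure ℝ) [IsProbabilityMeasure P] [IsProbabilityMeasure Q] :
    AEMeasurable (fun x => (quantile P x, quantile Q x)) (volume.restrict (Ioo (0:ℝ) 1)) :=
  (stmt12_q_aem P).prodMk (stmt12_q_aem Q)

theorem stmt12_isProb : IsProbabilityMeasure (volume.restrict (Ioo (0:ℝ) 1)) :=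
  ⟨by simp⟩

theorem stmt12com_prob (P Q : Measure ℝ) [IsProbabilityMeasure P] [IsProbabilityMeasure Q] :
    IsProbabilityMeasure (stmt12com P Q) :=
  haveI := stmt12_isProb
  Measure.isProbabilityMeasure_map (stmt12_pair_aem P Q)

theorem stmt12_q_map (P : Measure ℝ) [IsProbabilityMeasure P] :
    (volume.restrict (Ioo (0:ℝ) 1)).map (quantile P) = P := by
  haveI := stmt12_isProb
  haveI := Measure.isProbabilityMeasure_map (stmt12_q_aem P)
  refine Measure.ext_of_Iic _ _ fun a => ?_
  rw [Measure.map_apply_of_aemeasurable (stmt12_q_aem P) measurableSet_Iic,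
    Measure.restrict_apply' measurableSet_Ioo]
  have : quantile P ⁻¹' Iic a ∩ Ioo (0:ℝ) 1 = Iic (cdf P a) ∩ Ioo (0:ℝ) 1 := by
    ext x
    simp only [Set.mem_inter_iff, Set.mem_preimage, Set.mem_Iic]
    exact and_congr_left fun hx => stmt12_q_le P x a hx
  rw [this, ← stmt12_cdf_ofReal]
  refine le_antisymm ?_ ?_
  · refine (measure_mono (t := Ioc 0 (cdf P a)) ?_).trans (by simp)
    rintro x ⟨h1, h2⟩; exact ⟨h2.1, h1⟩
  · refine le_trans (by simp) (measure_mono (s := Ioo 0 (cdf P a)) ?_)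
    rintro x ⟨h1, h2⟩; exact ⟨h2.le, h1, h2.trans_le (stmt12_cdf_le_one P a)⟩

theorem stmt12com_fst (P Q : Measure ℝ) [IsProbabilityMeasure P] [IsProbabilityMeasure Q] :
    (stmt12com P Q).map Prod.fst = P := by
  unfold stmt12com
  rw [AEMeasurable.map_map_of_aemeasurable measurable_fst.aemeasurable (stmt12_pair_aem P Q)]
  exact stmt12_q_map P

theorem stmt12com_snd (P Q : Measure ℝ) [IsProbabilityMeasure P] [IsProbabilityMeasure Q] :
    (stmt12com P Q).map Prod.snd = Q := by
  unfold stmt12com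
  rw [AEMeasurable.map_map_of_aemeasurable measurable_snd.aemeasurable (stmt12_pair_aem P Q)]
  exact stmt12_q_map Q

theorem stmt12com_Iic (P Q : Measure ℝ) [IsProbabilityMeasure P] [IsProbabilityMeasure Q]
    (u v : ℝ) : stmt12com P Q (Iic u ×ˢ Iic v) = min (P (Iic u)) (Q (Iic v)) := by
  unfold stmt12com
  rw [Measure.map_apply_of_aemeasurable (stmt12_pair_aem P Q)
    (measurableSet_Iic.prod measurableSet_Iic), Measure.restrict_apply' measurableSet_Ioo,
    ← stmt12_cdf_ofReal, ← stmt12_cdf_ofReal, ← ENNReal.ofReal_min]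
  refine le_antisymm ?_ ?_
  · refine (measure_mono (t := Ioc 0 (min (cdf P u) (cdf Q v))) ?_).trans (by simp)
    rintro x ⟨⟨h1, h2⟩, hx⟩
    exact ⟨hx.1, le_min ((stmt12_q_le P x u hx).1 h1) ((stmt12_q_le Q x v hx).1 h2)⟩
  · refine le_trans (by simp) (measure_mono (s := Ioo 0 (min (cdf P u) (cdf Q v))) ?_)
    rintro x ⟨h1, h2⟩
    obtain ⟨h3, h4⟩ := lt_min_iff.1 h2
    have hx : x ∈ Ioo (0:ℝ) 1 := ⟨h1, h3.trans_le (stmt12_cdf_le_one P u)⟩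
    exact ⟨⟨(stmt12_q_le P x u hx).2 h3.le, (stmt12_q_le Q x v hx).2 h4.le⟩, hx⟩

theorem stmt12com_Ioi (P Q : Measure ℝ) [IsProbabilityMeasure P] [IsProbabilityMeasure Q]
    (u v : ℝ) : min (P (Ioi u)) (Q (Ioi v)) ≤ stmt12com P Q (Ioi u ×ˢ Ioi v) := by
  have hc : ∀ (R : Measure ℝ) [IsProbabilityMeasure R] (z : ℝ),
      R (Ioi z) = ENNReal.ofReal (1 - cdf R z) := by
    intro R _ z
    rw [← compl_Iic, prob_compl_eq_one_sub measurableSet_Iic,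
      ENNReal.ofReal_sub _ (stmt12_cdf_nonneg R z), stmt12_cdf_ofReal, ENNReal.ofReal_one]
  unfold stmt12com
  rw [Measure.map_apply_of_aemeasurable (stmt12_pair_aem P Q)
    (measurableSet_Ioi.prod measurableSet_Ioi), Measure.restrict_apply' measurableSet_Ioo,
    hc P, hc Q, ← ENNReal.ofReal_min, min_sub_sub_left]
  refine le_trans (by simp) (measure_mono (s := Ioo (max (cdf P u) (cdf Q v)) 1) ?_)
  rintro x ⟨h1, h2⟩
  obtain ⟨h3, h4⟩ := max_lt_iff.1 h1
  have hx : x ∈ Ioo (0:ℝ) 1 := ⟨(stmt12_cdf_nonneg P u).trans_lt h3, h2⟩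
  refine ⟨⟨?_, ?_⟩, hx⟩
  · exact not_le.1 fun h => absurd ((stmt12_q_le P x u hx).1 h) (not_le.2 h3)
  · exact not_le.1 fun h => absurd ((stmt12_q_le Q x v hx).1 h) (not_le.2 h4)

theorem stmt12com_unique (P Q : Measure ℝ) [IsProbabilityMeasure P] [IsProbabilityMeasure Q]
    (R : Measure (ℝ × ℝ)) [IsProbabilityMeasure R]
    (h : ∀ u v : ℝ, R (Iic u ×ˢ Iic v) = min (P (Iic u)) (Q (Iic v))) : R = stmt12com P Q := by
  haveI := stmt12com_prob P Q
  have hg : MeasurableSpace.generateFrom (range (Iic : ℝ → Set ℝ)) = inferInstanceAs (MeasurableSpace ℝ) := by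
    rw [← borel_eq_generateFrom_Iic]; exact (BorelSpace.measurable_eq (α := ℝ)).symm
  have hs : IsCountablySpanning (range (Iic : ℝ → Set ℝ)) :=
    ⟨fun n : ℕ => Iic (n : ℝ), fun n => ⟨_, rfl⟩, by
      ext x; simpa using exists_nat_ge x⟩
  refine ext_of_generate_finite _ (generateFrom_eq_prod hg hg hs hs).symm
    (isPiSystem_Iic.prod isPiSystem_Iic) ?_ (by simp)
  rintro _ ⟨_, ⟨u, rfl⟩, _, ⟨v, rfl⟩, rfl⟩
  simp only [h, stmt12com_Iic]

theorem stmt12_q_lim (P : Measure ℝ) [IsProbabilityMeasure P] (Pn : ℕ → Measure ℝ)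
    (hp : ∀ᶠ n in Filter.atTop, IsProbabilityMeasure (Pn n))
    (h : ∀ z, Filter.Tendsto (fun n => cdf (Pn n) z) Filter.atTop (nhds (cdf P z))) :
    ∀ᵐ x ∂(volume.restrict (Ioo (0:ℝ) 1)),
      Filter.Tendsto (fun n => quantile (Pn n) x) Filter.atTop (nhds (quantile P x)) := by
  have hcount : (range (fun r : ℚ => cdf P r)).Countable := countable_range _
  have h0 : ∀ᵐ x ∂(volume.restrict (Ioo (0:ℝ) 1)), x ∉ range (fun r : ℚ => cdf P r) :=
    ae_restrict_of_ae (hcount.ae_notMem _)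
  filter_upwards [h0, ae_restrict_mem measurableSet_Ioo] with x hx hx1
  rw [tendsto_order]
  constructor
  · intro a ha
    have h1 : cdf P a < x := not_le.1 fun hh => absurd ((stmt12_q_le P x a hx1).2 hh) (not_le.2 ha)
    filter_upwards [hp, (h a).eventually (gt_mem_nhds h1)] with n _ hn
    exact not_le.1 fun hh => absurd ((stmt12_q_le (Pn n) x a hx1).1 hh) (not_le.2 hn)
  · intro a ha
    obtain ⟨r, hr1, hr2⟩ := exists_rat_btwn ha
    have h1 : x ≤ cdf P r := (stmt12_q_le P x r hx1).1 hr1.le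
    have h2 : x < cdf P r := lt_of_le_of_ne h1 fun e => hx ⟨r, e.symm⟩
    filter_upwards [hp, (h r).eventually (lt_mem_nhds h2)] with n _ hn
    exact ((stmt12_q_le (Pn n) x r hx1).2 hn.le).trans_lt hr2

theorem stmt12_main (P Q : Measure ℝ) [IsProbabilityMeasure P] [IsProbabilityMeasure Q]
    (Υ : ℝ → ℝ → ℝ) (hcont : Continuous (fun p : ℝ × ℝ => Υ p.1 p.2))
    (hnn : ∀ u v : ℝ, 0 ≤ Υ u v)
    (hqa : ∀ u₁ u₂ v₁ v₂ : ℝ, u₁ ≤ u₂ → v₁ ≤ v₂ →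
      Υ u₁ v₁ + Υ u₂ v₂ ≤ Υ u₂ v₁ + Υ u₁ v₂)
    (π : Measure (ℝ × ℝ)) [IsProbabilityMeasure π]
    (h1 : π.map Prod.fst = P) (h2 : π.map Prod.snd = Q) :
    ∫⁻ x in Ioo (0:ℝ) 1, ENNReal.ofReal (Υ (quantile P x) (quantile Q x)) ≤
      ∫⁻ p, ENNReal.ofReal (Υ p.1 p.2) ∂π := by
  let B : ℕ → Set (ℝ × ℝ) := fun n => Icc (-(n:ℝ)) n ×ˢ Icc (-(n:ℝ)) n
  have hBm : ∀ n, MeasurableSet (B n) := fun n => measurableSet_Icc.prod measurableSet_Icc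
  let ρ : ℕ → Measure (ℝ × ℝ) := fun n => ProbabilityTheory.cond π (B n)
  let c : ℕ → ℝ → ℝ := fun n u => max (-(n:ℝ)) (min u n)
  have hBmono : Monotone B := by
    intro i j hij
    have : (i : ℝ) ≤ j := by exact_mod_cast hij
    exact Set.prod_mono (Icc_subset_Icc (by linarith) this) (Icc_subset_Icc (by linarith) this)
  have hBU : ⋃ n, B n = univ := by
    refine eq_univ_of_forall fun p => ?_
    obtain ⟨n, hn⟩ := exists_nat_ge (max |p.1| |p.2|)
    exact mem_iUnion.2 ⟨n, abs_le.1 ((le_max_left _ _).trans hn), abs_le.1 ((le_max_right _ _).trans hn)⟩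
  have hB1 : Filter.Tendsto (fun n => π (B n)) Filter.atTop (nhds 1) := by
    have := tendsto_measure_iUnion_atTop (μ := π) hBmono
    rwa [hBU, measure_univ] at this
  have hB0 : ∀ᶠ n in Filter.atTop, π (B n) ≠ 0 := by
    filter_upwards [hB1.eventually (lt_mem_nhds zero_lt_one)] with n hn using hn.ne'
  have hinv : Filter.Tendsto (fun n => (π (B n))⁻¹) Filter.atTop (nhds 1) := by
    simpa using ENNReal.tendsto_inv_iff.2 hB1
  have hρp : ∀ n, π (B n) ≠ 0 → IsProbabilityMeasure (ρ n) := fun n hn =>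
    ProbabilityTheory.cond_isProbabilityMeasure hn
  have hρlim : ∀ s, MeasurableSet s → Filter.Tendsto (fun n => ρ n s) Filter.atTop (nhds (π s)) := by
    intro s hs
    have e : ∀ n, ρ n s = (π (B n))⁻¹ * π (B n ∩ s) := fun n =>
      ProbabilityTheory.cond_apply (hBm n) π s
    simp_rw [e]
    have h3 : Filter.Tendsto (fun n => π (B n ∩ s)) Filter.atTop (nhds (π s)) := by
      have := tendsto_measure_iUnion_atTop (μ := π) (s := fun n => B n ∩ s)
        (fun i j hij => inter_subset_inter_left _ (hBmono hij))
      rwa [← iUnion_inter, hBU, univ_inter] at this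
    simpa using ENNReal.Tendsto.mul hinv (Or.inl one_ne_zero) h3 (Or.inr ENNReal.one_ne_top)
  have hlimc : ∀ f : ℝ × ℝ → ℝ, Measurable f → ∀ z,
      Filter.Tendsto (fun n => cdf ((ρ n).map f) z) Filter.atTop (nhds (cdf (π.map f) z)) := by
    intro f hf z
    unfold cdf
    refine (ENNReal.tendsto_toReal ?_).comp ?_
    · rw [Measure.map_apply hf measurableSet_Iic]; exact measure_ne_top _ _
    · simp_rw [Measure.map_apply hf measurableSet_Iic]
      exact hρlim _ (hf measurableSet_Iic)
  have hmp : ∀ f : ℝ × ℝ → ℝ, Measurable f → ∀ n, π (B n) ≠ 0 →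
      IsProbabilityMeasure ((ρ n).map f) := by
    intro f hf n hn
    haveI := hρp n hn
    exact Measure.isProbabilityMeasure_map hf.aemeasurable
  have hq1 := stmt12_q_lim P (fun n => (ρ n).map Prod.fst)
    (hB0.mono fun n hn => hmp _ measurable_fst n hn)
    (by have := hlimc _ measurable_fst; rwa [h1] at this)
  have hq2 := stmt12_q_lim Q (fun n => (ρ n).map Prod.snd)
    (hB0.mono fun n hn => hmp _ measurable_snd n hn)
    (by have := hlimc _ measurable_snd; rwa [h2] at this)
  have hcc : ∀ n, Continuous (c n) := fun n => by fun_prop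
  have hcm : ∀ n, Monotone (c n) := fun n u v huv =>
    max_le_max_left _ (min_le_min_right _ huv)
  have hcI : ∀ (n : ℕ) (u : ℝ), c n u ∈ Icc (-(n:ℝ)) n := fun n u =>
    ⟨le_max_left _ _, max_le (by have : (0:ℝ) ≤ n := n.cast_nonneg
                                 linarith) (min_le_right _ _)⟩
  have hcid : ∀ (n : ℕ) (u : ℝ), u ∈ Icc (-(n:ℝ)) n → c n u = u := fun n u hu => by
    simp only [c]; rw [min_eq_left hu.2, max_eq_right hu.1]
  have hclim : ∀ (y : ℕ → ℝ) (l : ℝ), Filter.Tendsto y Filter.atTop (nhds l) →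
      Filter.Tendsto (fun n => c n (y n)) Filter.atTop (nhds l) := by
    intro y l hy
    refine hy.congr' ?_
    have hb : ∀ᶠ n in Filter.atTop, |y n| < |l| + 1 :=
      hy.abs.eventually (gt_mem_nhds (lt_add_one _))
    obtain ⟨N, hN⟩ := exists_nat_ge (|l| + 1)
    filter_upwards [hb, Filter.eventually_ge_atTop N] with n hn hNn
    have : (N : ℝ) ≤ n := by exact_mod_cast hNn
    exact (hcid n _ (abs_le.1 (by linarith))).symm
  have hΥc : ∀ n, Continuous (fun p : ℝ × ℝ => Υ (c n p.1) (c n p.2)) := fun n =>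
    hcont.comp (((hcc n).comp continuous_fst).prodMk ((hcc n).comp continuous_snd))
  -- the finite level inequality
  have hfin : ∀ n, π (B n) ≠ 0 →
      ∫⁻ x in Ioo (0:ℝ) 1, ENNReal.ofReal (Υ (c n (quantile ((ρ n).map Prod.fst) x))
        (c n (quantile ((ρ n).map Prod.snd) x))) ≤
      (π (B n))⁻¹ * ∫⁻ p, ENNReal.ofReal (Υ p.1 p.2) ∂π := by
    intro n hn
    haveI := hρp n hn
    haveI := hmp _ measurable_fst n hn
    haveI := hmp _ measurable_snd n hn
    haveI := stmt12com_prob ((ρ n).map Prod.fst) ((ρ n).map Prod.snd)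
    obtain ⟨C, hC⟩ := ((isCompact_Icc.prod isCompact_Icc :
      IsCompact (Icc (-(n:ℝ)) n ×ˢ Icc (-(n:ℝ)) n))).exists_bound_of_continuousOn hcont.continuousOn
    have hC' : ∀ u v, |Υ (c n u) (c n v)| ≤ C := fun u v => hC (c n u, c n v) ⟨hcI n u, hcI n v⟩
    have hb := stmt12_bdd (ρ n) (stmt12com ((ρ n).map Prod.fst) ((ρ n).map Prod.snd))
      (stmt12com_fst _ _).symm (stmt12com_snd _ _).symm (fun a b => by
        refine le_trans (le_min ?_ ?_) (stmt12com_Ioi _ _ a b)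
        · rw [Measure.map_apply measurable_fst measurableSet_Ioi]
          exact measure_mono fun p hp => hp.1
        · rw [Measure.map_apply measurable_snd measurableSet_Ioi]
          exact measure_mono fun p hp => hp.2)
      (fun u v => Υ (c n u) (c n v)) (hΥc n) C hC'
      (fun u₁ u₂ v₁ v₂ hu hv => hqa _ _ _ _ (hcm n hu) (hcm n hv))
    have hint : ∀ (τ : Measure (ℝ × ℝ)) [IsProbabilityMeasure τ],
        Integrable (fun p : ℝ × ℝ => Υ (c n p.1) (c n p.2)) τ := fun τ _ =>
      Integrable.of_bound (hΥc n).measurable.aestronglyMeasurable C (ae_of_all _ fun p => hC' _ _)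
    have hb' := ENNReal.ofReal_le_ofReal hb
    rw [ofReal_integral_eq_lintegral_ofReal (hint _) (ae_of_all _ fun p => hnn _ _),
      ofReal_integral_eq_lintegral_ofReal (hint _) (ae_of_all _ fun p => hnn _ _)] at hb'
    have hme : Measurable fun p : ℝ × ℝ => ENNReal.ofReal (Υ (c n p.1) (c n p.2)) :=
      (hΥc n).measurable.ennreal_ofReal
    rw [stmt12com, lintegral_map' hme.aemeasurable (stmt12_pair_aem _ _)] at hb'
    refine hb'.trans ?_
    simp only [ρ, ProbabilityTheory.cond]
    rw [lintegral_smul_measure, smul_eq_mul]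
    refine mul_le_mul_right ?_ _
    refine le_trans (le_of_eq (setLIntegral_congr_fun (hBm n) fun p hp => ?_))
      (setLIntegral_le_lintegral (B n) _)
    simp only [hcid n _ hp.1, hcid n _ hp.2]
  let f : ℕ → ℝ → ENNReal := fun n x =>
    if π (B n) = 0 then ⊤ else ENNReal.ofReal (Υ (c n (quantile ((ρ n).map Prod.fst) x))
        (c n (quantile ((ρ n).map Prod.snd) x)))
  have hfm : ∀ n, AEMeasurable (f n) (volume.restrict (Ioo (0:ℝ) 1)) := by
    intro n
    by_cases hn : π (B n) = 0
    · simp only [f, hn, if_true]; exact aemeasurable_const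
    · simp only [f, hn, if_false]
      haveI := hmp _ measurable_fst n hn
      haveI := hmp _ measurable_snd n hn
      exact ((hΥc n).measurable.ennreal_ofReal).comp_aemeasurable (stmt12_pair_aem
        ((ρ n).map Prod.fst) ((ρ n).map Prod.snd))
  have hfl : ∀ᵐ x ∂(volume.restrict (Ioo (0:ℝ) 1)),
      ENNReal.ofReal (Υ (quantile P x) (quantile Q x)) =
        Filter.liminf (fun n => f n x) Filter.atTop := by
    filter_upwards [hq1, hq2] with x hx1 hx2
    symm
    apply Filter.Tendsto.liminf_eq
    have : Filter.Tendsto (fun n => ENNReal.ofReal (Υ (c n (quantile ((ρ n).map Prod.fst) x))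
        (c n (quantile ((ρ n).map Prod.snd) x)))) Filter.atTop
        (nhds (ENNReal.ofReal (Υ (quantile P x) (quantile Q x)))) :=
      ENNReal.tendsto_ofReal ((hcont.tendsto (quantile P x, quantile Q x)).comp
        ((hclim _ _ hx1).prodMk_nhds (hclim _ _ hx2)))
    refine this.congr' ?_
    filter_upwards [hB0] with n hn
    simp only [f, hn, if_false]
  rw [lintegral_congr_ae hfl]
  refine (lintegral_liminf_le' hfm).trans ?_
  have hR : Filter.Tendsto (fun n => (π (B n))⁻¹ * ∫⁻ p, ENNReal.ofReal (Υ p.1 p.2) ∂π)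
      Filter.atTop (nhds (∫⁻ p, ENNReal.ofReal (Υ p.1 p.2) ∂π)) := by
    simpa using ENNReal.Tendsto.mul_const hinv (Or.inl one_ne_zero)
      (b := ∫⁻ p, ENNReal.ofReal (Υ p.1 p.2) ∂π)
  rw [← hR.liminf_eq]
  refine Filter.liminf_le_liminf ?_
  filter_upwards [hB0] with n hn
  simp only [f, hn, if_false]
  exact hfin n hn


/-- For a continuous, nonnegative, quasi-antitone (submodular) cost `Υ`,
the comonotone coupling `Pcom` (characterized by the joint cdf `min{F_P(u), F_Q(v)}`)
minimizes `∫ Υ dπ` among all couplings `π` of `P` and `Q`, and the minimal value is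
`∫₀¹ Υ(F_P^←(x), F_Q^←(x)) dx`. -/
theorem stmt12 (P Q : Measure ℝ) [IsProbabilityMeasure P] [IsProbabilityMeasure Q]
    (Υ : ℝ → ℝ → ℝ) (hcont : Continuous (fun p : ℝ × ℝ => Υ p.1 p.2))
    (hnn : ∀ u v : ℝ, 0 ≤ Υ u v)
    (hqa : ∀ u₁ u₂ v₁ v₂ : ℝ, u₁ ≤ u₂ → v₁ ≤ v₂ →
      Υ u₁ v₁ + Υ u₂ v₂ ≤ Υ u₂ v₁ + Υ u₁ v₂)
    (Pcom : Measure (ℝ × ℝ)) [IsProbabilityMeasure Pcom]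
    (hPcom₁ : Pcom.map Prod.fst = P) (hPcom₂ : Pcom.map Prod.snd = Q)
    (hcdf : ∀ u v : ℝ, Pcom (Iic u ×ˢ Iic v) = min (P (Iic u)) (Q (Iic v))) :
    (∀ π : Measure (ℝ × ℝ), IsProbabilityMeasure π →
        π.map Prod.fst = P → π.map Prod.snd = Q →
        ∫⁻ p, ENNReal.ofReal (Υ p.1 p.2) ∂Pcom ≤ ∫⁻ p, ENNReal.ofReal (Υ p.1 p.2) ∂π) ∧
    ∫⁻ p, ENNReal.ofReal (Υ p.1 p.2) ∂Pcom
      = ∫⁻ x in Ioo (0:ℝ) 1, ENNReal.ofReal (Υ (quantile P x) (quantile Q x)) := by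
  have he := stmt12com_unique P Q Pcom hcdf
  have heq : ∫⁻ p, ENNReal.ofReal (Υ p.1 p.2) ∂Pcom
      = ∫⁻ x in Ioo (0:ℝ) 1, ENNReal.ofReal (Υ (quantile P x) (quantile Q x)) := by
    rw [he, stmt12com, lintegral_map' hcont.measurable.ennreal_ofReal.aemeasurable
      (stmt12_pair_aem P Q)]
  refine ⟨fun π hπ h1 h2 => ?_, heq⟩
  rw [heq]
  exact stmt12_main P Q Υ hcont hnn hqa π h1 h2
end

section
/- Let Υ : ℝ × ℝ → [0,∞) be continuous and quasi-antitone, let P be a probability measure on ℝ with continuous cdf F_P, and Q a probability measure on ℝ. Then for the map T^com := F_Q^← ∘ F_P, the value ∫ Υ(u, T^com(u)) dP(u) equals the infimum of ∫ Υ(u, T(u)) dP(u) over all measurable maps T : ℝ → ℝ pushing P forward to Q (the Monge problem), and this common value equals ∫₀¹ Υ(F_P^←(x), F_Q^←(x)) dx. -/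
open MeasureTheory Set ENNReal

open Filter Topology

section quant
variable (P : Measure ℝ) [IsFiniteMeasure P]

lemma cdf_mono' : Monotone (cdf P) := fun _ _ h =>
  ENNReal.toReal_mono (measure_ne_top _ _) (measure_mono (Iic_subset_Iic.2 h))

lemma cdf_nonneg' (z : ℝ) : 0 ≤ cdf P z := ENNReal.toReal_nonneg

lemma cdf_le' (z : ℝ) : cdf P z ≤ P.real univ :=
  ENNReal.toReal_mono (measure_ne_top _ _) (measure_mono (subset_univ _))

lemma cdf_bot' : Tendsto (cdf P) atBot (𝓝 0) := by
  have := tendsto_measure_iInter_atBot (μ := P) (s := fun z : ℝ => Iic z)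
    (fun n => measurableSet_Iic.nullMeasurableSet) (fun a b hab => Iic_subset_Iic.2 hab)
    ⟨0, measure_ne_top _ _⟩
  have he : ⋂ z : ℝ, Iic z = ∅ := by
    ext x
    simp only [mem_iInter, mem_Iic, mem_empty_iff_false, iff_false, not_forall]
    exact ⟨x - 1, by linarith⟩
  rw [he, measure_empty] at this
  have h2 := (ENNReal.tendsto_toReal (by simp : (0:ℝ≥0∞) ≠ ⊤)).comp this
  exact h2

lemma cdf_top' : Tendsto (cdf P) atTop (𝓝 (P.real univ)) := by
  have := tendsto_measure_Iic_atTop P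
  exact (ENNReal.tendsto_toReal (measure_ne_top P univ)).comp this

lemma cdf_right' (z : ℝ) : Tendsto (fun n : ℕ => cdf P (z + 1 / ((n : ℝ) + 1))) atTop (𝓝 (cdf P z)) := by
  have h : Iic z = ⋂ n : ℕ, Iic (z + 1 / ((n : ℝ) + 1)) := by
    ext x
    simp only [mem_Iic, mem_iInter]
    constructor
    · intro hx n
      have : (0:ℝ) < 1 / ((n : ℝ) + 1) := by positivity
      linarith
    · intro hx
      have ht : Tendsto (fun n : ℕ => z + 1 / ((n : ℝ) + 1)) atTop (𝓝 (z + 0)) :=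
        tendsto_const_nhds.add tendsto_one_div_add_atTop_nhds_zero_nat
      rw [add_zero] at ht
      exact ge_of_tendsto' ht hx
  have := tendsto_measure_iInter_atTop (μ := P) (s := fun n : ℕ => Iic (z + 1 / ((n : ℝ) + 1)))
    (fun n => measurableSet_Iic.nullMeasurableSet) 
    (fun a b hab => Iic_subset_Iic.2 (by
      have := Nat.one_div_le_one_div (α := ℝ) hab
      linarith)) ⟨0, measure_ne_top _ _⟩
  rw [← h] at this
  exact (ENNReal.tendsto_toReal (measure_ne_top P _)).comp this

lemma quantile_le_iff {x : ℝ} (hx : x ∈ Ioo 0 (P.real univ)) (z : ℝ) :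
    quantile P x ≤ z ↔ x ≤ cdf P z := by
  have hbdd : BddBelow {z : ℝ | x ≤ cdf P z} := by
    obtain ⟨y, hy⟩ := ((cdf_bot' P).eventually (gt_mem_nhds hx.1)).exists
    refine ⟨y, fun w hw => ?_⟩
    by_contra! hlt
    exact absurd (cdf_mono' P hlt.le) (not_le.2 (lt_of_lt_of_le hy hw))
  have hne : {z : ℝ | x ≤ cdf P z}.Nonempty := by
    obtain ⟨y, hy⟩ := ((cdf_top' P).eventually (lt_mem_nhds hx.2)).exists
    exact ⟨y, hy.le⟩
  constructor
  · intro h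
    refine ge_of_tendsto' (cdf_right' P z) fun n => ?_
    have : quantile P x < z + 1 / ((n : ℝ) + 1) := by
      have : (0:ℝ) < 1 / ((n : ℝ) + 1) := by positivity
      linarith
    obtain ⟨w, hw, hwz⟩ := exists_lt_of_csInf_lt hne this
    exact le_trans hw (cdf_mono' P hwz.le)
  · intro h
    exact csInf_le hbdd h

lemma quantile_meas : Measurable (quantile P) := by
  refine measurable_of_Iic fun z => ?_
  have h0 : ∀ x ≤ 0, quantile P x = 0 := fun x hx => by
    have : {z : ℝ | x ≤ cdf P z} = univ := by
      ext z; simpa using hx.trans (cdf_nonneg' P z)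
    simp [quantile, this]
  have h1 : ∀ x, P.real univ < x → quantile P x = 0 := fun x hx => by
    have : {z : ℝ | x ≤ cdf P z} = ∅ := by
      ext z; simpa using (cdf_le' P z).trans_lt hx
    simp [quantile, this]
  have : quantile P ⁻¹' Iic z = (Iic 0 ∩ {_x | 0 ≤ z}) ∪ (Ioo 0 (P.real univ) ∩ Iic (cdf P z))
      ∪ ({P.real univ} ∩ quantile P ⁻¹' Iic z) ∪ (Ioi (P.real univ) ∩ {_x | 0 ≤ z}) := by
    ext x
    rcases le_or_gt x 0 with hx | hx
    · have := h0 x hx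
      have hm : (0:ℝ) ≤ P.real univ := measureReal_nonneg
      simp only [mem_preimage, mem_Iic, mem_union, mem_inter_iff, mem_Ioo, mem_Ioi, mem_ofPred_eq,
        mem_singleton_iff, this]
      grind
    rcases lt_trichotomy x (P.real univ) with hx' | hx' | hx'
    · have := quantile_le_iff P ⟨hx, hx'⟩ z
      simp only [mem_preimage, mem_Iic, mem_union, mem_inter_iff, mem_Ioo, mem_Ioi, mem_ofPred_eq,
        mem_singleton_iff, this]
      grind
    · simp only [mem_preimage, mem_Iic, mem_union, mem_inter_iff, mem_Ioo, mem_Ioi, mem_ofPred_eq,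
        mem_singleton_iff]
      grind
    · have := h1 x hx'
      simp only [mem_preimage, mem_Iic, mem_union, mem_inter_iff, mem_Ioo, mem_Ioi, mem_ofPred_eq,
        mem_singleton_iff, this]
      grind
  rw [this]
  refine (((measurableSet_Iic.inter (MeasurableSet.const _)).union
    (measurableSet_Ioo.inter measurableSet_Iic)).union ?_).union
    (measurableSet_Ioi.inter (MeasurableSet.const _))
  exact ((finite_singleton _).subset inter_subset_left).measurableSet

lemma map_quantile : (volume.restrict (Ioo 0 (P.real univ))).map (quantile P) = P := by
  refine Measure.ext_of_Iic _ _ fun z => ?_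
  rw [Measure.map_apply (quantile_meas P) measurableSet_Iic,
    Measure.restrict_apply (quantile_meas P measurableSet_Iic)]
  have h : quantile P ⁻¹' Iic z ∩ Ioo 0 (P.real univ) = Ioc 0 (cdf P z) ∩ Iio (P.real univ) := by
    ext x
    constructor
    · rintro ⟨h1, h2⟩
      exact ⟨⟨h2.1, (quantile_le_iff P h2 z).1 h1⟩, h2.2⟩
    · rintro ⟨⟨h1, h2⟩, h3⟩
      exact ⟨(quantile_le_iff P ⟨h1, h3⟩ z).2 h2, h1, h3⟩
  rw [h]
  have h2 : volume (Ioc 0 (cdf P z) ∩ Iio (P.real univ)) = volume (Ioc 0 (cdf P z)) := by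
    apply measure_congr
    have : ∀ᵐ x : ℝ, x ≠ P.real univ := by
      simp [ae_iff]
    filter_upwards [this] with x hx
    have := cdf_le' P z
    refine propext ⟨fun h => h.1, fun h => ⟨h, lt_of_le_of_ne (h.2.trans this) hx⟩⟩
  rw [h2, Real.volume_Ioc, sub_zero, cdf, ENNReal.ofReal_toReal (measure_ne_top _ _)]

end quant

lemma cdf_quantile (P : Measure ℝ) [IsFiniteMeasure P] (hc : Continuous (cdf P)) {x : ℝ}
    (hx : x ∈ Ioo 0 (P.real univ)) : cdf P (quantile P x) = x := by
  apply le_antisymm _ ((quantile_le_iff P hx _).1 le_rfl)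
  by_contra! h
  have h1 : ∀ᶠ z in 𝓝[<] (quantile P x), x < cdf P z :=
    (hc.tendsto _ |>.mono_left nhdsWithin_le_nhds).eventually (lt_mem_nhds h)
  obtain ⟨z, hz, hz'⟩ := (h1.and self_mem_nhdsWithin).exists
  exact absurd ((quantile_le_iff P hx z).2 hz.le) (not_le.2 hz')

/-- joint tails under the comonotone coupling -/
lemma como_joint (π : Measure (ℝ × ℝ)) [IsFiniteMeasure π] (P Q : Measure ℝ) [IsFiniteMeasure P]
    [IsFiniteMeasure Q]
    (hP : π.map Prod.fst = P) (hQ : π.map Prod.snd = Q) (hPQ : P.real univ = Q.real univ) (a b : ℝ) :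
    π.real (Ioi a ×ˢ Ioi b) ≤
     ((volume.restrict (Ioo 0 (P.real univ))).map (fun x => (quantile P x, quantile Q x))).real
      (Ioi a ×ˢ Ioi b) := by
  have hm : Measurable (fun x => (quantile P x, quantile Q x)) :=
    (quantile_meas P).prodMk (quantile_meas Q)
  have hms : MeasurableSet (Ioi a ×ˢ Ioi b) := measurableSet_Ioi.prod measurableSet_Ioi
  rw [measureReal_def, measureReal_def]
  refine ENNReal.toReal_mono (measure_ne_top _ _) ?_
  rw [Measure.map_apply hm hms, Measure.restrict_apply (hm hms)]
  rcases le_total (cdf P a) (cdf Q b) with h | h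
  · calc π (Ioi a ×ˢ Ioi b) ≤ π (Prod.snd ⁻¹' Ioi b) := measure_mono fun p hp => hp.2
      _ = Q (Ioi b) := by rw [← hQ, Measure.map_apply measurable_snd measurableSet_Ioi]
      _ = volume (quantile Q ⁻¹' Ioi b ∩ Ioo 0 (Q.real univ)) := by
        conv_lhs => rw [← map_quantile Q]
        rw [Measure.map_apply (quantile_meas Q) measurableSet_Ioi,
          Measure.restrict_apply (quantile_meas Q measurableSet_Ioi)]
      _ ≤ _ := by
        refine measure_mono fun x hx => ?_
        have h1 := quantile_le_iff Q hx.2 b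
        have hx2 := hx.2
        rw [← hPQ] at hx2
        have h2 := quantile_le_iff P hx2 a
        have h3 : b < quantile Q x := hx.1
        refine ⟨⟨?_, h3⟩, hx2⟩
        show a < quantile P x
        rw [← not_le, h1] at h3
        rw [← not_le, h2]
        exact fun h4 => h3 (h4.trans h)
  · calc π (Ioi a ×ˢ Ioi b) ≤ π (Prod.fst ⁻¹' Ioi a) := measure_mono fun p hp => hp.1
      _ = P (Ioi a) := by rw [← hP, Measure.map_apply measurable_fst measurableSet_Ioi]
      _ = volume (quantile P ⁻¹' Ioi a ∩ Ioo 0 (P.real univ)) := by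
        conv_lhs => rw [← map_quantile P]
        rw [Measure.map_apply (quantile_meas P) measurableSet_Ioi,
          Measure.restrict_apply (quantile_meas P measurableSet_Ioi)]
      _ ≤ _ := by
        refine measure_mono fun x hx => ?_
        have h1 := quantile_le_iff P hx.2 a
        have hx2 := hx.2
        rw [hPQ] at hx2
        have h2 := quantile_le_iff Q hx2 b
        have h3 : a < quantile P x := hx.1
        refine ⟨⟨h3, ?_⟩, hx.2⟩
        show b < quantile Q x
        rw [← not_le, h1] at h3
        rw [← not_le, h2]
        exact fun h4 => h3 (h4.trans h)
lemma telesc (f : ℕ → ℕ → ℝ) (N k l : ℕ) (hk : k ≤ N) (hl : l ≤ N) :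
    ∑ i ∈ Finset.range N, ∑ j ∈ Finset.range N,
      (f (i+1) (j+1) - f i (j+1) - f (i+1) j + f i j) * (if i < k ∧ j < l then 1 else 0)
     = f k l - f 0 l - f k 0 + f 0 0 := by
  have h1 : ∀ i, ∑ j ∈ Finset.range N,
      (f (i+1) (j+1) - f i (j+1) - f (i+1) j + f i j) * (if i < k ∧ j < l then (1:ℝ) else 0)
      = (if i < k then (f (i+1) l - f i l - f (i+1) 0 + f i 0) else 0) := by
    intro i
    by_cases hi : i < k
    · simp only [hi, true_and, mul_ite, mul_one, mul_zero, if_true]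
      rw [← Finset.sum_filter]
      have : Finset.filter (fun j => j < l) (Finset.range N) = Finset.range l := by
        ext j; simp; omega
      rw [this]
      have := Finset.sum_range_sub (fun j => f (i+1) j - f i j) l
      rw [← sub_eq_zero] at this ⊢
      rw [← this]
      have e : ∑ j ∈ Finset.range l, (f (i+1) (j+1) - f i (j+1) - f (i+1) j + f i j) =
        ∑ j ∈ Finset.range l, (f (i+1) (j+1) - f i (j+1) - (f (i+1) j - f i j)) :=
        Finset.sum_congr rfl fun j _ => by ring
      rw [e]; ring
    · simp [hi]
  simp only [h1]
  rw [← Finset.sum_filter]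
  have : Finset.filter (fun j => j < k) (Finset.range N) = Finset.range k := by
    ext j; simp; omega
  rw [this]
  have := Finset.sum_range_sub (fun i => f i l - f i 0) k
  rw [← sub_eq_zero] at this ⊢
  rw [← this]
  have e : ∑ i ∈ Finset.range k, (f (i+1) l - f i l - f (i+1) 0 + f i 0) =
    ∑ i ∈ Finset.range k, (f (i+1) l - f (i+1) 0 - (f i l - f i 0)) :=
    Finset.sum_congr rfl fun j _ => by ring
  rw [e]; ring

/-- grid points -/
noncomputable def gpt (M n i : ℕ) : ℝ := -(M:ℝ) + (i:ℝ) / ((n:ℝ) + 1)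

/-- grid index -/
noncomputable def gidx (M n : ℕ) (u : ℝ) : ℕ := ⌈(u + M) * ((n:ℝ)+1)⌉₊

lemma lt_gidx (M n i : ℕ) (u : ℝ) : i < gidx M n u ↔ gpt M n i < u := by
  have : (0:ℝ) < (n:ℝ)+1 := by positivity
  rw [gidx, Nat.lt_ceil, gpt, ← div_lt_iff₀ this]
  constructor <;> intro h <;> linarith

lemma gidx_le (M n : ℕ) (u : ℝ) (hu : u ≤ M) : gidx M n u ≤ 2 * M * (n+1) := by
  rw [gidx, Nat.ceil_le]
  push_cast
  have : (0:ℝ) < (n:ℝ)+1 := by positivity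
  nlinarith

lemma gpt_zero (M n : ℕ) : gpt M n 0 = -(M:ℝ) := by simp [gpt]

lemma gpt_mono (M n i : ℕ) : gpt M n i ≤ gpt M n (i+1) := by
  unfold gpt
  gcongr
  simp

lemma gpt_gidx_ge (M n : ℕ) (u : ℝ) : u ≤ gpt M n (gidx M n u) := by
  by_contra! h
  exact lt_irrefl _ ((lt_gidx M n _ u).2 h)

lemma gpt_gidx_le (M n : ℕ) (u : ℝ) (hu : -(M:ℝ) ≤ u) :
    gpt M n (gidx M n u) ≤ u + 1 / ((n:ℝ)+1) := by
  have h0 : (0:ℝ) < (n:ℝ)+1 := by positivity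
  have h := (Nat.ceil_lt_add_one (a := (u + M) * ((n:ℝ)+1)) (by nlinarith)).le
  unfold gpt gidx
  have : (⌈(u + M) * ((n:ℝ)+1)⌉₊ : ℝ) / ((n:ℝ)+1) ≤ ((u + M) * ((n:ℝ)+1) + 1) / ((n:ℝ)+1) := by
    gcongr
  have e : ((u + M) * ((n:ℝ)+1) + 1) / ((n:ℝ)+1) = u + M + 1 / ((n:ℝ)+1) := by field_simp
  linarith

lemma gpt_tendsto (M : ℕ) (u : ℝ) (hu : -(M:ℝ) ≤ u) :
    Tendsto (fun n => gpt M n (gidx M n u)) atTop (𝓝 u) := by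
  have ht : Tendsto (fun n : ℕ => u + 1 / ((n : ℝ) + 1)) atTop (𝓝 (u + 0)) :=
    tendsto_const_nhds.add tendsto_one_div_add_atTop_nhds_zero_nat
  rw [add_zero] at ht
  exact tendsto_of_tendsto_of_tendsto_of_le_of_le tendsto_const_nhds ht
    (fun n => gpt_gidx_ge M n u) (fun n => gpt_gidx_le M n u hu)

/-- second difference approximant -/
noncomputable def gPhi (Υ : ℝ → ℝ → ℝ) (M n : ℕ) (p : ℝ × ℝ) : ℝ :=
  ∑ i ∈ Finset.range (2 * M * (n+1)), ∑ j ∈ Finset.range (2 * M * (n+1)),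
    (Υ (gpt M n (i+1)) (gpt M n (j+1)) - Υ (gpt M n i) (gpt M n (j+1))
      - Υ (gpt M n (i+1)) (gpt M n j) + Υ (gpt M n i) (gpt M n j)) *
      (Ioi (gpt M n i) ×ˢ Ioi (gpt M n j)).indicator (fun _ => (1:ℝ)) p

lemma gPhi_eq (Υ : ℝ → ℝ → ℝ) (M n : ℕ) (p : ℝ × ℝ) (h1 : p.1 ≤ M) (h2 : p.2 ≤ M) :
    gPhi Υ M n p = Υ (gpt M n (gidx M n p.1)) (gpt M n (gidx M n p.2))
      - Υ (-M) (gpt M n (gidx M n p.2)) - Υ (gpt M n (gidx M n p.1)) (-M) + Υ (-M) (-M) := by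
  have := telesc (fun i j => Υ (gpt M n i) (gpt M n j)) (2 * M * (n+1)) (gidx M n p.1)
    (gidx M n p.2) (gidx_le M n _ h1) (gidx_le M n _ h2)
  simp only [gpt_zero] at this
  rw [← this, gPhi]
  refine Finset.sum_congr rfl fun i _ => Finset.sum_congr rfl fun j _ => ?_
  congr 1
  simp only [lt_gidx, indicator, mem_prod, mem_Ioi]

lemma gPhi_integral (Υ : ℝ → ℝ → ℝ) (M n : ℕ) (π : Measure (ℝ × ℝ)) [IsFiniteMeasure π] :
    ∫ p, gPhi Υ M n p ∂π = ∑ i ∈ Finset.range (2 * M * (n+1)), ∑ j ∈ Finset.range (2 * M * (n+1)),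
    (Υ (gpt M n (i+1)) (gpt M n (j+1)) - Υ (gpt M n i) (gpt M n (j+1))
      - Υ (gpt M n (i+1)) (gpt M n j) + Υ (gpt M n i) (gpt M n j)) *
      π.real (Ioi (gpt M n i) ×ˢ Ioi (gpt M n j)) := by
  have hms : ∀ a b : ℝ, MeasurableSet (Ioi a ×ˢ Ioi b) :=
    fun a b => measurableSet_Ioi.prod measurableSet_Ioi
  have hint : ∀ a b : ℝ, Integrable ((Ioi a ×ˢ Ioi b).indicator (fun _ => (1:ℝ))) π :=
    fun a b => (integrable_const _).indicator (hms a b)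
  unfold gPhi
  rw [integral_finsetSum]
  · refine Finset.sum_congr rfl fun i _ => ?_
    rw [integral_finsetSum]
    · refine Finset.sum_congr rfl fun j _ => ?_
      rw [integral_const_mul, integral_indicator (hms _ _)]
      simp
    · exact fun j _ => (hint _ _).const_mul _
  · exact fun i _ => integrable_finsetSum _ fun j _ => (hint _ _).const_mul _

lemma gPhi_tendsto (Υ : ℝ → ℝ → ℝ) (hcont : Continuous (fun p : ℝ × ℝ => Υ p.1 p.2))
    (M : ℕ) (π : Measure (ℝ × ℝ)) [IsFiniteMeasure π]
    (hbox : ∀ᵐ p ∂π, p ∈ Icc (-(M:ℝ)) M ×ˢ Icc (-(M:ℝ)) M) :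
    Tendsto (fun n => ∫ p, gPhi Υ M n p ∂π) atTop
      (𝓝 (∫ p, (Υ p.1 p.2 - Υ (-M) p.2 - Υ p.1 (-M) + Υ (-M) (-M)) ∂π)) := by
  have hK : IsCompact (Icc (-(M:ℝ)) (M+1) ×ˢ Icc (-(M:ℝ)) (M+1)) := isCompact_Icc.prod isCompact_Icc
  obtain ⟨C, hC⟩ := hK.exists_bound_of_continuousOn hcont.continuousOn
  have hM : -(M:ℝ) ≤ M + 1 := by have : (0:ℝ) ≤ M := by positivity
                                 linarith
  have hmem : ∀ n : ℕ, ∀ u ∈ Icc (-(M:ℝ)) M, gpt M n (gidx M n u) ∈ Icc (-(M:ℝ)) (M+1) := by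
    intro n u hu
    have h1 := gpt_gidx_ge M n u
    have h2 := gpt_gidx_le M n u hu.1
    have h3 : 1 / ((n:ℝ)+1) ≤ 1 := by
      rw [div_le_one (by positivity)]; simp
    exact ⟨hu.1.trans h1, by linarith [hu.2]⟩
  refine tendsto_integral_of_dominated_convergence (fun _ => C + C + C + C) ?_ ?_ ?_ ?_
  · intro n
    apply Measurable.aestronglyMeasurable
    unfold gPhi
    refine Finset.measurable_sum _ fun i _ => Finset.measurable_sum _ fun j _ => ?_
    exact (measurable_const.indicator (measurableSet_Ioi.prod measurableSet_Ioi)).const_mul _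
  · exact integrable_const _
  · intro n
    filter_upwards [hbox] with p hp
    rw [gPhi_eq Υ M n p hp.1.2 hp.2.2]
    have a1 := hmem n _ hp.1
    have a2 := hmem n _ hp.2
    have a3 : -(M:ℝ) ∈ Icc (-(M:ℝ)) (M+1) := ⟨le_rfl, hM⟩
    have b1 := abs_le.1 (hC (gpt M n (gidx M n p.1), gpt M n (gidx M n p.2)) ⟨a1, a2⟩)
    have b2 := abs_le.1 (hC (-(M:ℝ), gpt M n (gidx M n p.2)) ⟨a3, a2⟩)
    have b3 := abs_le.1 (hC (gpt M n (gidx M n p.1), -(M:ℝ)) ⟨a1, a3⟩)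
    have b4 := abs_le.1 (hC (-(M:ℝ), -(M:ℝ)) ⟨a3, a3⟩)
    simp only at b1 b2 b3 b4
    rw [Real.norm_eq_abs, abs_le]
    constructor <;> linarith [b1.1, b1.2, b2.1, b2.2, b3.1, b3.2, b4.1, b4.2]
  · filter_upwards [hbox] with p hp
    have e : (fun n => gPhi Υ M n p) = fun n => 
      Υ (gpt M n (gidx M n p.1)) (gpt M n (gidx M n p.2))
      - Υ (-M) (gpt M n (gidx M n p.2)) - Υ (gpt M n (gidx M n p.1)) (-M) + Υ (-M) (-M) :=
      funext fun n => gPhi_eq Υ M n p hp.1.2 hp.2.2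
    rw [e]
    have t1 := gpt_tendsto M p.1 hp.1.1
    have t2 := gpt_tendsto M p.2 hp.2.1
    have key : ∀ (f g : ℕ → ℝ) (x y : ℝ), Tendsto f atTop (𝓝 x) → Tendsto g atTop (𝓝 y) →
        Tendsto (fun n => Υ (f n) (g n)) atTop (𝓝 (Υ x y)) := fun f g x y hf hg =>
      (hcont.tendsto (x, y)).comp (hf.prodMk_nhds hg)
    exact (((key _ _ _ _ t1 t2).sub (key _ _ _ _ tendsto_const_nhds t2)).sub
      (key _ _ _ _ t1 tendsto_const_nhds)).add tendsto_const_nhds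

lemma box_ineq (Υ : ℝ → ℝ → ℝ) (hcont : Continuous (fun p : ℝ × ℝ => Υ p.1 p.2))
    (hqa : ∀ u₁ u₂ v₁ v₂ : ℝ, u₁ ≤ u₂ → v₁ ≤ v₂ →
      Υ u₁ v₁ + Υ u₂ v₂ ≤ Υ u₂ v₁ + Υ u₁ v₂)
    (M : ℕ) (π π' : Measure (ℝ × ℝ)) [IsFiniteMeasure π] [IsFiniteMeasure π']
    (hbox : ∀ᵐ p ∂π, p ∈ Icc (-(M:ℝ)) M ×ˢ Icc (-(M:ℝ)) M)
    (h1 : π.map Prod.fst = π'.map Prod.fst) (h2 : π.map Prod.snd = π'.map Prod.snd)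
    (hj : ∀ a b, π.real (Ioi a ×ˢ Ioi b) ≤ π'.real (Ioi a ×ˢ Ioi b)) :
    Integrable (fun p => Υ p.1 p.2) π ∧ Integrable (fun p => Υ p.1 p.2) π' ∧
    ∫ p, Υ p.1 p.2 ∂π' ≤ ∫ p, Υ p.1 p.2 ∂π := by
  have hbox' : ∀ᵐ p ∂π', p ∈ Icc (-(M:ℝ)) M ×ˢ Icc (-(M:ℝ)) M := by
    have c1 : ∀ᵐ p ∂π', p.1 ∈ Icc (-(M:ℝ)) M := by
      refine (ae_map_iff measurable_fst.aemeasurable measurableSet_Icc).1 ?_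
      rw [← h1]
      refine (ae_map_iff measurable_fst.aemeasurable measurableSet_Icc).2 ?_
      exact hbox.mono fun p hp => hp.1
    have c2 : ∀ᵐ p ∂π', p.2 ∈ Icc (-(M:ℝ)) M := by
      refine (ae_map_iff measurable_snd.aemeasurable measurableSet_Icc).1 ?_
      rw [← h2]
      refine (ae_map_iff measurable_snd.aemeasurable measurableSet_Icc).2 ?_
      exact hbox.mono fun p hp => hp.2
    filter_upwards [c1, c2] with p q1 q2 using ⟨q1, q2⟩
  have hlim := le_of_tendsto_of_tendsto' (gPhi_tendsto Υ hcont M π' hbox')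
    (gPhi_tendsto Υ hcont M π hbox) (fun n => by
      rw [gPhi_integral, gPhi_integral]
      refine Finset.sum_le_sum fun i _ => Finset.sum_le_sum fun j _ => ?_
      refine mul_le_mul_of_nonpos_left (hj _ _) ?_
      have := hqa _ _ _ _ (gpt_mono M n i) (gpt_mono M n j)
      linarith)
  have hK : IsCompact (Icc (-(M:ℝ)) M ×ˢ Icc (-(M:ℝ)) M) := isCompact_Icc.prod isCompact_Icc
  have hM : -(M:ℝ) ∈ Icc (-(M:ℝ)) M := ⟨le_rfl, by have : (0:ℝ) ≤ M := by positivity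
                                                   linarith⟩
  have hint : ∀ (ρ : Measure (ℝ × ℝ)) [IsFiniteMeasure ρ],
      (∀ᵐ p ∂ρ, p ∈ Icc (-(M:ℝ)) M ×ˢ Icc (-(M:ℝ)) M) →
      ∀ f : ℝ × ℝ → ℝ, Continuous f → Integrable f ρ := by
    intro ρ _ hρ f hf
    obtain ⟨C, hC⟩ := hK.exists_bound_of_continuousOn hf.continuousOn
    exact Integrable.of_bound hf.aestronglyMeasurable C (hρ.mono fun p hp => hC p hp)
  have f1 : Continuous (fun p : ℝ × ℝ => Υ (-M) p.2) :=
    hcont.comp (continuous_const.prodMk continuous_snd)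
  have f2 : Continuous (fun p : ℝ × ℝ => Υ p.1 (-M)) :=
    hcont.comp (continuous_fst.prodMk continuous_const)
  have g1 : Continuous (fun v : ℝ => Υ (-M) v) :=
    hcont.comp (continuous_const.prodMk continuous_id)
  have g2 : Continuous (fun v : ℝ => Υ v (-M)) :=
    hcont.comp (continuous_id.prodMk continuous_const)
  have exp : ∀ (ρ : Measure (ℝ × ℝ)) [IsFiniteMeasure ρ],
      (∀ᵐ p ∂ρ, p ∈ Icc (-(M:ℝ)) M ×ˢ Icc (-(M:ℝ)) M) →
      ∫ p, (Υ p.1 p.2 - Υ (-M) p.2 - Υ p.1 (-M) + Υ (-M) (-M)) ∂ρ =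
      ∫ p, Υ p.1 p.2 ∂ρ - ∫ v, Υ (-M) v ∂(ρ.map Prod.snd) - ∫ u, Υ u (-M) ∂(ρ.map Prod.fst)
        + ∫ u, Υ (-M) (-M) ∂(ρ.map Prod.fst) := by
    intro ρ _ hρ
    rw [integral_map measurable_snd.aemeasurable g1.aestronglyMeasurable,
      integral_map measurable_fst.aemeasurable g2.aestronglyMeasurable,
      integral_map measurable_fst.aemeasurable aestronglyMeasurable_const]
    have i0 := hint ρ hρ _ hcont
    have i1 := hint ρ hρ _ f1
    have i2 := hint ρ hρ _ f2
    have j1 : Integrable (fun p : ℝ × ℝ => Υ p.1 p.2 - Υ (-M) p.2) ρ := i0.sub i1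
    have j2 : Integrable (fun p : ℝ × ℝ => Υ p.1 p.2 - Υ (-M) p.2 - Υ p.1 (-M)) ρ := j1.sub i2
    rw [integral_add j2 (integrable_const _), integral_sub j1 i2, integral_sub i0 i1]
  rw [exp π hbox, exp π' hbox', h1, h2] at hlim
  exact ⟨hint π hbox _ hcont, hint π' hbox' _ hcont, by linarith⟩
lemma quantile_tendsto (P : Measure ℝ) [IsFiniteMeasure P] (Pn : ℕ → Measure ℝ)
    [∀ n, IsFiniteMeasure (Pn n)] (hle : ∀ n z, cdf (Pn n) z ≤ cdf P z)
    (hlim : ∀ z, Tendsto (fun n => cdf (Pn n) z) atTop (𝓝 (cdf P z)))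
    (x : ℝ) (hx : x ∈ Ioo 0 (P.real univ)) (hm : ∀ᶠ n in atTop, x < (Pn n).real univ)
    (hx' : x ∉ range (fun r : ℚ => cdf P r)) :
    Tendsto (fun n => quantile (Pn n) x) atTop (𝓝 (quantile P x)) := by
  rw [tendsto_order]
  constructor
  · intro a ha
    filter_upwards [hm] with n hn
    refine ha.trans_le ?_
    rw [quantile_le_iff P hx]
    exact ((quantile_le_iff (Pn n) ⟨hx.1, hn⟩ _).1 le_rfl).trans (hle _ _)
  · intro a ha
    obtain ⟨r, hr1, hr2⟩ := exists_rat_btwn ha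
    have h1 : x < cdf P r :=
      lt_of_le_of_ne ((quantile_le_iff P hx _).1 hr1.le) fun h => hx' ⟨r, h.symm⟩
    filter_upwards [hm, (hlim r).eventually (lt_mem_nhds h1)] with n hn hn2
    exact ((quantile_le_iff (Pn n) ⟨hx.1, hn⟩ _).2 hn2.le).trans_lt hr2

lemma lower_bound (Υ : ℝ → ℝ → ℝ) (hcont : Continuous (fun p : ℝ × ℝ => Υ p.1 p.2))
    (hnn : ∀ u v : ℝ, 0 ≤ Υ u v)
    (hqa : ∀ u₁ u₂ v₁ v₂ : ℝ, u₁ ≤ u₂ → v₁ ≤ v₂ →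
      Υ u₁ v₁ + Υ u₂ v₂ ≤ Υ u₂ v₁ + Υ u₁ v₂)
    (π : Measure (ℝ × ℝ)) [IsProbabilityMeasure π] (P Q : Measure ℝ) [IsProbabilityMeasure P]
    [IsProbabilityMeasure Q] (hP : π.map Prod.fst = P) (hQ : π.map Prod.snd = Q) :
    ∫⁻ x in Ioo (0:ℝ) 1, ENNReal.ofReal (Υ (quantile P x) (quantile Q x)) ≤
      ∫⁻ p, ENNReal.ofReal (Υ p.1 p.2) ∂π := by
  set B : ℕ → Set (ℝ × ℝ) := fun M => Icc (-(M:ℝ)) M ×ˢ Icc (-(M:ℝ)) M with hB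
  have hBm : ∀ M, MeasurableSet (B M) := fun M => measurableSet_Icc.prod measurableSet_Icc
  have hBmono : Monotone B := fun a b hab => by
    have : (a:ℝ) ≤ b := by exact_mod_cast hab
    exact prod_mono (Icc_subset_Icc (by linarith) this) (Icc_subset_Icc (by linarith) this)
  have hBU : ⋃ M, B M = univ := by
    refine eq_univ_of_forall fun p => ?_
    obtain ⟨M, hM⟩ := exists_nat_ge (max |p.1| |p.2|)
    have h1 := abs_le.1 ((le_max_left _ _).trans hM)
    have h2 := abs_le.1 ((le_max_right _ _).trans hM)
    exact mem_iUnion.2 ⟨M, ⟨h1.1, h1.2⟩, ⟨h2.1, h2.2⟩⟩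
  have hBlim : ∀ S : Set (ℝ × ℝ), 
      Tendsto (fun M => (π (S ∩ B M)).toReal) atTop (𝓝 (π S).toReal) := by
    intro S
    have hmono : Monotone (fun M => S ∩ B M) := fun a b hab => inter_subset_inter_right _ (hBmono hab)
    have := tendsto_measure_iUnion_atTop (μ := π) hmono
    rw [← inter_iUnion, hBU, inter_univ] at this
    exact (ENNReal.tendsto_toReal (measure_ne_top _ _)).comp this
  set PM : ℕ → Measure ℝ := fun M => (π.restrict (B M)).map Prod.fst with hPM
  set QM : ℕ → Measure ℝ := fun M => (π.restrict (B M)).map Prod.snd with hQM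
  have : ∀ M, IsFiniteMeasure (PM M) := fun M => by rw [hPM]; infer_instance
  have : ∀ M, IsFiniteMeasure (QM M) := fun M => by rw [hQM]; infer_instance
  have appP : ∀ M S, MeasurableSet S → PM M S = π (Prod.fst ⁻¹' S ∩ B M) := fun M S hS => by
    rw [hPM]
    simp only
    rw [Measure.map_apply measurable_fst hS, Measure.restrict_apply (measurable_fst hS)]
  have appQ : ∀ M S, MeasurableSet S → QM M S = π (Prod.snd ⁻¹' S ∩ B M) := fun M S hS => by
    rw [hQM]
    simp only
    rw [Measure.map_apply measurable_snd hS, Measure.restrict_apply (measurable_snd hS)]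
  have appP' : ∀ S, MeasurableSet S → P S = π (Prod.fst ⁻¹' S) := fun S hS => by
    rw [← hP, Measure.map_apply measurable_fst hS]
  have appQ' : ∀ S, MeasurableSet S → Q S = π (Prod.snd ⁻¹' S) := fun S hS => by
    rw [← hQ, Measure.map_apply measurable_snd hS]
  have mP : ∀ M, (PM M).real univ = π.real (B M) := fun M => by
    rw [measureReal_def, appP M _ MeasurableSet.univ]; simp [measureReal_def]
  have mQ : ∀ M, (QM M).real univ = π.real (B M) := fun M => by
    rw [measureReal_def, appQ M _ MeasurableSet.univ]; simp [measureReal_def]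
  have mlim : Tendsto (fun M => π.real (B M)) atTop (𝓝 1) := by
    have := hBlim univ
    simpa [measureReal_def] using this
  have mle : ∀ M, π.real (B M) ≤ 1 := fun M => measureReal_le_one
  -- inequality on boxes
  have hbox : ∀ M, ∫⁻ x in Ioo (0:ℝ) (π.real (B M)),
      ENNReal.ofReal (Υ (quantile (PM M) x) (quantile (QM M) x)) ≤
      ∫⁻ p, ENNReal.ofReal (Υ p.1 p.2) ∂π := by
    intro M
    have hm : Measurable (fun x => (quantile (PM M) x, quantile (QM M) x)) :=
      (quantile_meas _).prodMk (quantile_meas _)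
    set π' := (volume.restrict (Ioo 0 ((PM M).real univ))).map
      (fun x => (quantile (PM M) x, quantile (QM M) x)) with hπ'
    have e1 : π'.map Prod.fst = PM M := by
      rw [hπ', Measure.map_map measurable_fst hm]
      exact map_quantile (PM M)
    have e2 : π'.map Prod.snd = QM M := by
      rw [hπ', Measure.map_map measurable_snd hm, mP, ← mQ]
      exact map_quantile (QM M)
    obtain ⟨i1, i2, hle⟩ := box_ineq Υ hcont hqa M (π.restrict (B M)) π' (ae_restrict_mem (hBm M))
      e1.symm e2.symm (fun a b => como_joint (π.restrict (B M)) (PM M) (QM M) rfl rfl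
        ((mP M).trans (mQ M).symm) a b)
    have hme : Measurable (fun p : ℝ × ℝ => ENNReal.ofReal (Υ p.1 p.2)) :=
      hcont.measurable.ennreal_ofReal
    calc _ = ∫⁻ p, ENNReal.ofReal (Υ p.1 p.2) ∂π' := by
          rw [hπ', lintegral_map hme hm, mP]
      _ = ENNReal.ofReal (∫ p, Υ p.1 p.2 ∂π') :=
          (ofReal_integral_eq_lintegral_ofReal i2 (Eventually.of_forall fun p => hnn _ _)).symm
      _ ≤ ENNReal.ofReal (∫ p, Υ p.1 p.2 ∂(π.restrict (B M))) := ENNReal.ofReal_le_ofReal hle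
      _ = ∫⁻ p in B M, ENNReal.ofReal (Υ p.1 p.2) ∂π :=
          ofReal_integral_eq_lintegral_ofReal i1 (Eventually.of_forall fun p => hnn _ _)
      _ ≤ _ := setLIntegral_le_lintegral _ _
  -- Fatou
  set g : ℕ → ℝ → ℝ≥0∞ := fun M => (Ioo (0:ℝ) (π.real (B M))).indicator
    (fun x => ENNReal.ofReal (Υ (quantile (PM M) x) (quantile (QM M) x))) with hg
  have hgm : ∀ M, Measurable (g M) := fun M =>
    (hcont.measurable.comp ((quantile_meas (PM M)).prodMk (quantile_meas (QM M)))).ennreal_ofReal.indicator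
      measurableSet_Ioo
  have hgi : ∀ M, ∫⁻ x in Ioo (0:ℝ) 1, g M x ≤ ∫⁻ p, ENNReal.ofReal (Υ p.1 p.2) ∂π := fun M => by
    refine le_trans ?_ (hbox M)
    rw [← lintegral_indicator (measurableSet_Ioo (a := (0:ℝ)) (b := π.real (B M)))]
    exact setLIntegral_le_lintegral _ _
  have hcount : ∀ R : Measure ℝ, ∀ᵐ x : ℝ, x ∉ range (fun r : ℚ => cdf R r) := fun R =>
    (countable_range _).ae_notMem _
  calc _ ≤ ∫⁻ x in Ioo (0:ℝ) 1, liminf (fun M => g M x) atTop := by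
        refine lintegral_mono_ae ?_
        filter_upwards [ae_restrict_mem measurableSet_Ioo, ae_restrict_of_ae (hcount P),
          ae_restrict_of_ae (hcount Q)] with x hx hxP hxQ
        have hxm : ∀ᶠ M in atTop, x < π.real (B M) := mlim.eventually (lt_mem_nhds hx.2)
        have t1 : Tendsto (fun M => quantile (PM M) x) atTop (𝓝 (quantile P x)) := by
          refine quantile_tendsto P PM ?_ ?_ x (by simpa using hx) (by simpa only [mP] using hxm) hxP
          · intro n z
            rw [cdf, cdf, appP _ _ measurableSet_Iic, appP' _ measurableSet_Iic]
            exact ENNReal.toReal_mono (measure_ne_top _ _) (measure_mono inter_subset_left)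
          · intro z
            simp only [cdf, appP _ _ measurableSet_Iic, appP' _ measurableSet_Iic]
            exact hBlim _
        have t2 : Tendsto (fun M => quantile (QM M) x) atTop (𝓝 (quantile Q x)) := by
          refine quantile_tendsto Q QM ?_ ?_ x (by simpa using hx) (by simpa only [mQ] using hxm) hxQ
          · intro n z
            rw [cdf, cdf, appQ _ _ measurableSet_Iic, appQ' _ measurableSet_Iic]
            exact ENNReal.toReal_mono (measure_ne_top _ _) (measure_mono inter_subset_left)
          · intro z
            simp only [cdf, appQ _ _ measurableSet_Iic, appQ' _ measurableSet_Iic]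
            exact hBlim _
        have t3 : Tendsto (fun M => ENNReal.ofReal (Υ (quantile (PM M) x) (quantile (QM M) x)))
            atTop (𝓝 (ENNReal.ofReal (Υ (quantile P x) (quantile Q x)))) :=
          ENNReal.tendsto_ofReal ((hcont.tendsto (quantile P x, quantile Q x)).comp
            (t1.prodMk_nhds t2))
        have t4 : Tendsto (fun M => g M x)
            atTop (𝓝 (ENNReal.ofReal (Υ (quantile P x) (quantile Q x)))) := by
          refine t3.congr' ?_
          filter_upwards [hxm] with M hM
          rw [hg]
          simp only
          rw [indicator_of_mem (show x ∈ Ioo (0:ℝ) (π.real (B M)) from ⟨hx.1, hM⟩)]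
        exact t4.liminf_eq.ge
    _ ≤ liminf (fun M => ∫⁻ x in Ioo (0:ℝ) 1, g M x) atTop := lintegral_liminf_le hgm
    _ ≤ _ := liminf_le_of_le (by isBoundedDefault) fun b hb => by
        obtain ⟨M, hM⟩ := hb.exists
        exact hM.trans (hgi M)

theorem stmt16 (Υ : ℝ → ℝ → ℝ) (hcont : Continuous (fun p : ℝ × ℝ => Υ p.1 p.2))
    (hnn : ∀ u v : ℝ, 0 ≤ Υ u v)
    (hqa : ∀ u₁ u₂ v₁ v₂ : ℝ, u₁ ≤ u₂ → v₁ ≤ v₂ →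
      Υ u₁ v₁ + Υ u₂ v₂ ≤ Υ u₂ v₁ + Υ u₁ v₂)
    (P Q : Measure ℝ) [IsProbabilityMeasure P] [IsProbabilityMeasure Q]
    (hcdfP : Continuous (cdf P)) :
    (∫⁻ u, ENNReal.ofReal (Υ u (quantile Q (cdf P u))) ∂P)
        = sInf { I : ℝ≥0∞ | ∃ T : ℝ → ℝ, Measurable T ∧ P.map T = Q ∧
            I = ∫⁻ u, ENNReal.ofReal (Υ u (T u)) ∂P } ∧
    (∫⁻ u, ENNReal.ofReal (Υ u (quantile Q (cdf P u))) ∂P)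
        = ∫⁻ x in Ioo (0:ℝ) 1, ENNReal.ofReal (Υ (quantile P x) (quantile Q x)) := by
  have hT : Measurable (fun u => quantile Q (cdf P u)) :=
    (quantile_meas Q).comp hcdfP.measurable
  have mapP : (volume.restrict (Ioo (0:ℝ) 1)).map (quantile P) = P := by
    simpa using map_quantile P
  have mapQ : (volume.restrict (Ioo (0:ℝ) 1)).map (quantile Q) = Q := by
    simpa using map_quantile Q
  have hcq : ∀ᵐ x ∂(volume.restrict (Ioo (0:ℝ) 1)), cdf P (quantile P x) = x := by
    filter_upwards [ae_restrict_mem measurableSet_Ioo] with x hx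
    exact cdf_quantile P hcdfP (by simpa using hx)
  have h2 : (∫⁻ u, ENNReal.ofReal (Υ u (quantile Q (cdf P u))) ∂P)
        = ∫⁻ x in Ioo (0:ℝ) 1, ENNReal.ofReal (Υ (quantile P x) (quantile Q x)) := by
    have hm : Measurable (fun u => ENNReal.ofReal (Υ u (quantile Q (cdf P u)))) :=
      (hcont.measurable.comp (measurable_id.prodMk hT)).ennreal_ofReal
    have h3 := lintegral_map (μ := volume.restrict (Ioo (0:ℝ) 1)) hm (quantile_meas P)
    rw [mapP] at h3
    rw [h3]
    refine lintegral_congr_ae ?_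
    filter_upwards [hcq] with x hx
    rw [hx]
  refine ⟨le_antisymm ?_ ?_, h2⟩
  · refine le_sInf ?_
    rintro I ⟨T, hTm, hTQ, rfl⟩
    rw [h2]
    have hid : Measurable (fun u => (u, T u)) := measurable_id.prodMk hTm
    have : IsProbabilityMeasure (P.map (fun u => (u, T u))) :=
      Measure.isProbabilityMeasure_map hid.aemeasurable
    refine (lower_bound Υ hcont hnn hqa (P.map (fun u => (u, T u))) P Q ?_ ?_).trans ?_
    · rw [Measure.map_map measurable_fst hid]
      exact Measure.map_id
    · rw [Measure.map_map measurable_snd hid]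
      exact hTQ
    · rw [lintegral_map hcont.measurable.ennreal_ofReal hid]
  · refine sInf_le ⟨_, hT, ?_, rfl⟩
    have h3 := Measure.map_map (μ := volume.restrict (Ioo (0:ℝ) 1)) hT (quantile_meas P)
    rw [mapP] at h3
    rw [h3]
    refine Eq.trans (Measure.map_congr ?_) mapQ
    filter_upwards [hcq] with x hx
    simp [hx]
end
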